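/- Let ν be any probability measure on ℝ^n whose support is included in the euclidean ball B(0,R), and let ν^H = ν * μ, where μ(dx) = e^{-H(x)} dx is a probability measure such that sup_x |Hess H(x)| = K < ∞ (operator norm of the Hessian). If for some ε > 0 one has s := ((1+ε)/4) K² R² C_P(μ) < 1, then C_P(ν^H) ≤ ((1+ε⁻¹)/(1−s)) C_P(μ). -/

import Mathlib

open MeasureTheory Real Set
open scoped ENNReal RealInnerProductSpace Pointwise Matrix

noncomputable section

/-- Euclidean space ℝ^n. -/
abbrev En (n : ℕ) := EuclideanSpace ℝ (Fin n)

/-- Test functions: smooth, bounded and Lipschitz. -/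
def IsTestFun {n : ℕ} (f : En n → ℝ) : Prop :=
  ContDiff ℝ (⊤ : ℕ∞) f ∧ (∃ M, ∀ x, |f x| ≤ M) ∧ ∃ L, LipschitzWith L f

/-- `μ` satisfies a Poincaré inequality with constant `C`. -/
def PoincareLE {n : ℕ} (μ : Measure (En n)) (C : ℝ) : Prop :=
  ∀ f : En n → ℝ, IsTestFun f →
    (∫ x, (f x) ^ 2 ∂μ) - (∫ x, f x ∂μ) ^ 2 ≤ C * ∫ x, ‖gradient f x‖ ^ 2 ∂μ

/-- `μ` satisfies a logarithmic Sobolev inequality with constant `C`. -/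
def LogSobolevLE {n : ℕ} (μ : Measure (En n)) (C : ℝ) : Prop :=
  ∀ f : En n → ℝ, IsTestFun f →
    (∫ x, (f x) ^ 2 * Real.log ((f x) ^ 2) ∂μ)
        - (∫ x, (f x) ^ 2 ∂μ) * Real.log (∫ x, (f x) ^ 2 ∂μ)
      ≤ C * ∫ x, ‖gradient f x‖ ^ 2 ∂μ

/-- `μ` satisfies an L¹-Poincaré inequality (around the mean) with constant `C`. -/
def CheegerMeanLE {n : ℕ} (μ : Measure (En n)) (C : ℝ) : Prop :=
  ∀ f : En n → ℝ, IsTestFun f →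
    ∫ x, |f x - ∫ y, f y ∂μ| ∂μ ≤ C * ∫ x, ‖gradient f x‖ ∂μ

/-- `m` is a median of `f` under `μ`. -/
def IsMedian {n : ℕ} (μ : Measure (En n)) (f : En n → ℝ) (m : ℝ) : Prop :=
  ENNReal.ofReal (1 / 2) ≤ μ {x | f x ≤ m} ∧ ENNReal.ofReal (1 / 2) ≤ μ {x | m ≤ f x}

/-- `μ` satisfies a Cheeger inequality (around medians) with constant `C`. -/
def CheegerMedianLE {n : ℕ} (μ : Measure (En n)) (C : ℝ) : Prop :=
  ∀ f : En n → ℝ, IsTestFun f → ∀ m : ℝ, IsMedian μ f m →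
    ∫ x, |f x - m| ∂μ ≤ C * ∫ x, ‖gradient f x‖ ∂μ

/-- The perturbed (normalized) measure `μ_F = Z_F⁻¹ e^{-F} μ`. -/
def perturb {n : ℕ} (μ : Measure (En n)) (F : En n → ℝ) : Measure (En n) :=
  (ENNReal.ofReal (∫ x, Real.exp (-F x) ∂μ))⁻¹ •
    μ.withDensity fun x => ENNReal.ofReal (Real.exp (-F x))

/-- Topological support of a measure. -/
def measSupport {n : ℕ} (μ : Measure (En n)) : Set (En n) :=
  {x | ∀ U ∈ nhds x, 0 < μ U}

/-- `μ` is log-concave: it has density `e^{-W}` on a convex set, with `W` convex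
(equivalently, density `e^{-W}` with `W : ℝⁿ → ℝ ∪ {+∞}` convex). -/
def IsLogConcave {n : ℕ} (μ : Measure (En n)) : Prop :=
  ∃ (s : Set (En n)) (W : En n → ℝ), Convex ℝ s ∧ ConvexOn ℝ s W ∧
    μ = volume.withDensity (s.indicator fun x => ENNReal.ofReal (Real.exp (-W x)))

/-- The Laplacian of `F`. -/
def laplacian {n : ℕ} (F : En n → ℝ) (x : En n) : ℝ :=
  ∑ i : Fin n,
    fderiv ℝ (fun y => fderiv ℝ F y (EuclideanSpace.single i (1 : ℝ))) x
      (EuclideanSpace.single i (1 : ℝ))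

/-- The generator `A F = ΔF - ∇V·∇F` associated with `μ = e^{-V} dx`. -/
def genA {n : ℕ} (V F : En n → ℝ) (x : En n) : ℝ :=
  laplacian F x - ⟪gradient V x, gradient F x⟫

/-- The centered Gaussian measure on ℝ^n with covariance matrix `σ² Id`. -/
def gaussMeasure (n : ℕ) (σ : ℝ) : Measure (En n) :=
  volume.withDensity fun x =>
    ENNReal.ofReal ((2 * π * σ ^ 2) ^ (-(n : ℝ) / 2) * Real.exp (-‖x‖ ^ 2 / (2 * σ ^ 2)))

/-- Convolution of two measures. -/
def mconv {n : ℕ} (μ ν : Measure (En n)) : Measure (En n) :=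
  (μ.prod ν).map fun p => p.1 + p.2

/-- Concentration profile of `μ`. -/
def concProfile {n : ℕ} (μ : Measure (En n)) (r : ℝ) : ℝ :=
  sSup {t | ∃ A : Set (En n), MeasurableSet A ∧ (1 : ℝ) / 2 ≤ (μ A).toReal ∧
    t = 1 - (μ (A + Metric.ball (0 : En n) r)).toReal}

/-- Generalized inverse of the concentration profile. -/
def concInv {n : ℕ} (μ : Measure (En n)) (s : ℝ) : ℝ :=
  sInf {r | 0 < r ∧ concProfile μ r ≤ s}

/-- The Hessian matrix of `V` at `x`. -/
def hessMat {n : ℕ} (V : En n → ℝ) (x : En n) : Matrix (Fin n) (Fin n) ℝ :=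
  fun i j =>
    fderiv ℝ (fun y => fderiv ℝ V y (EuclideanSpace.single j (1 : ℝ))) x
      (EuclideanSpace.single i (1 : ℝ))

end

section Auxiliary

open Filter Topology ContinuousLinearMap

theorem norm_gradient {n : ℕ} (f : En n → ℝ) (x : En n) : ‖gradient f x‖ = ‖fderiv ℝ f x‖ := by
  simp [gradient]

theorem isTestFun_of_hasCompactSupport {n : ℕ} {f : En n → ℝ} (hf : ContDiff ℝ (⊤ : ℕ∞) f)
    (hc : HasCompactSupport f) : IsTestFun f := by
  obtain ⟨M, hM⟩ := hc.exists_bound_of_continuous hf.continuous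
  exact ⟨hf, ⟨M, hM⟩, hf.lipschitzWith_of_hasCompactSupport hc (by simp)⟩

/-- Smooth approximations of a compactly supported `C¹` function, converging pointwise together
with their derivatives and with uniform bounds. -/
theorem exists_smooth_approx {n : ℕ} {g : En n → ℝ} (hg : ContDiff ℝ 1 g)
    (hc : HasCompactSupport g) :
    ∃ (u : ℕ → En n → ℝ) (M : ℝ), (∀ k, ContDiff ℝ (⊤ : ℕ∞) (u k)) ∧
      (∀ k, HasCompactSupport (u k)) ∧ (∀ k x, ‖u k x‖ ≤ M) ∧ (∀ k x, ‖fderiv ℝ (u k) x‖ ≤ M) ∧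
      (∀ x, Tendsto (fun k => u k x) atTop (𝓝 (g x))) ∧
      (∀ x, Tendsto (fun k => fderiv ℝ (u k) x) atTop (𝓝 (fderiv ℝ g x))) := by
  have hg' : Continuous (fderiv ℝ g) := hg.continuous_fderiv one_ne_zero
  obtain ⟨M₀, hM₀⟩ := hc.exists_bound_of_continuous hg.continuous
  obtain ⟨M₁, hM₁⟩ := (hc.fderiv ℝ).exists_bound_of_continuous hg'
  let φ : ℕ → ContDiffBump (0 : En n) := fun k =>
    { rIn := 1 / ((k : ℝ) + 1) / 2
      rOut := 1 / ((k : ℝ) + 1)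
      rIn_pos := by positivity
      rIn_lt_rOut := half_lt_self (by positivity) }
  have hφ : Tendsto (fun k => (φ k).rOut) atTop (𝓝 0) := tendsto_one_div_add_atTop_nhds_zero_nat
  have hφc : ∀ k, Continuous ((φ k).normed (volume : Measure (En n))) := fun k =>
    ((φ k).contDiff_normed (n := 0)).continuous
  let u : ℕ → En n → ℝ := fun k => convolution ((φ k).normed volume) g (lsmul ℝ ℝ) volume
  have hL : (lsmul ℝ ℝ : ℝ →L[ℝ] ℝ →L[ℝ] ℝ).precompR (En n)
      = (lsmul ℝ ℝ : ℝ →L[ℝ] (En n →L[ℝ] ℝ) →L[ℝ] (En n →L[ℝ] ℝ)) := by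
    ext
    simp
  have hD : ∀ k x, fderiv ℝ (u k) x
      = convolution ((φ k).normed volume) (fderiv ℝ g) (lsmul ℝ ℝ) volume x := by
    intro k x
    have := (hc.hasFDerivAt_convolution_right (lsmul ℝ ℝ : ℝ →L[ℝ] ℝ →L[ℝ] ℝ)
      ((hφc k).locallyIntegrable (μ := volume)) hg x).fderiv
    rw [hL] at this
    exact this
  have hbound : ∀ {F : Type} [NormedAddCommGroup F] [NormedSpace ℝ F] [CompleteSpace F]
      {h : En n → F} {M : ℝ}, Continuous h → (∀ x, ‖h x‖ ≤ M) → ∀ k x,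
      ‖convolution ((φ k).normed volume) h (lsmul ℝ ℝ) volume x‖ ≤ 3 * M := by
    intro F _ _ _ h M hh hM k x
    have h1 := (φ k).dist_normed_convolution_le (μ := volume) (x₀ := x) (ε := 2 * M)
      hh.aestronglyMeasurable (fun y _ => by
        rw [dist_eq_norm]
        linarith [norm_sub_le (h y) (h x), hM x, hM y])
    rw [dist_eq_norm] at h1
    linarith [norm_le_norm_add_norm_sub' (convolution ((φ k).normed volume) h (lsmul ℝ ℝ) volume x)
      (h x), hM x]
  refine ⟨u, max (3 * M₀) (3 * M₁), fun k => ?_, fun k => ?_, fun k x => ?_, fun k x => ?_,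
    fun x => ?_, fun x => ?_⟩
  · exact (φ k).hasCompactSupport_normed.contDiff_convolution_left _ (φ k).contDiff_normed
      hg.continuous.locallyIntegrable
  · exact (φ k).hasCompactSupport_normed.convolution _ hc
  · exact (hbound hg.continuous hM₀ k x).trans (le_max_left _ _)
  · rw [hD]
    exact (hbound hg' hM₁ k x).trans (le_max_right _ _)
  · exact ContDiffBump.convolution_tendsto_right_of_continuous hφ hg.continuous x
  · simp_rw [hD]
    exact ContDiffBump.convolution_tendsto_right_of_continuous hφ hg' x

theorem PoincareLE.of_hasCompactSupport {n : ℕ} {μ : Measure (En n)} [IsFiniteMeasure μ] {C : ℝ}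
    (hP : PoincareLE μ C) {g : En n → ℝ} (hg : ContDiff ℝ 1 g) (hc : HasCompactSupport g) :
    (∫ x, (g x) ^ 2 ∂μ) - (∫ x, g x ∂μ) ^ 2 ≤ C * ∫ x, ‖fderiv ℝ g x‖ ^ 2 ∂μ := by
  obtain ⟨u, M, hu, huc, hM, hM', ht, ht'⟩ := exists_smooth_approx hg hc
  have huF : ∀ k, Continuous (fderiv ℝ (u k)) := fun k => (hu k).continuous_fderiv (by simp)
  have h1 : Tendsto (fun k => ∫ x, (u k x) ^ 2 ∂μ) atTop (𝓝 (∫ x, (g x) ^ 2 ∂μ)) := by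
    refine tendsto_integral_of_dominated_convergence (fun _ => M ^ 2)
      (fun k => ((hu k).continuous.pow 2).aestronglyMeasurable) (integrable_const _)
      (fun k => ae_of_all _ fun x => ?_) (ae_of_all _ fun x => (ht x).pow 2)
    rw [norm_pow]
    exact pow_le_pow_left₀ (norm_nonneg _) (hM k x) 2
  have h2 : Tendsto (fun k => ∫ x, u k x ∂μ) atTop (𝓝 (∫ x, g x ∂μ)) :=
    tendsto_integral_of_dominated_convergence (fun _ => M)
      (fun k => (hu k).continuous.aestronglyMeasurable) (integrable_const _)
      (fun k => ae_of_all _ fun x => hM k x) (ae_of_all _ ht)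
  have h3 : Tendsto (fun k => ∫ x, ‖fderiv ℝ (u k) x‖ ^ 2 ∂μ) atTop
      (𝓝 (∫ x, ‖fderiv ℝ g x‖ ^ 2 ∂μ)) := by
    refine tendsto_integral_of_dominated_convergence (fun _ => M ^ 2)
      (fun k => ((huF k).norm.pow 2).aestronglyMeasurable) (integrable_const _)
      (fun k => ae_of_all _ fun x => ?_) (ae_of_all _ fun x => (ht' x).norm.pow 2)
    rw [norm_pow, norm_norm]
    exact pow_le_pow_left₀ (norm_nonneg _) (hM' k x) 2
  refine le_of_tendsto_of_tendsto' (h1.sub (h2.pow 2)) (h3.const_mul C) fun k => ?_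
  have := hP (u k) (isTestFun_of_hasCompactSupport (hu k) (huc k))
  simpa only [norm_gradient] using this

/-- Smooth compactly supported cutoffs, eventually equal to `1` near every point, with values in
`[0, 1]` and uniformly bounded derivatives. -/
theorem exists_smooth_cutoff (n : ℕ) :
    ∃ (χ : ℕ → En n → ℝ) (M : ℝ), (∀ k, ContDiff ℝ 1 (χ k)) ∧ (∀ k, HasCompactSupport (χ k)) ∧
      (∀ k x, |χ k x| ≤ 1) ∧ (∀ k x, ‖fderiv ℝ (χ k) x‖ ≤ M) ∧
      (∀ x, ∀ᶠ k in atTop, χ k =ᶠ[𝓝 x] 1) := by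
  let φ : ContDiffBump (0 : En n) := ⟨1, 2, one_pos, one_lt_two⟩
  have hφ : ContDiff ℝ 1 φ := φ.contDiff
  obtain ⟨M, hM⟩ := (φ.hasCompactSupport.fderiv ℝ).exists_bound_of_continuous
    (hφ.continuous_fderiv one_ne_zero)
  have hk : ∀ k : ℕ, (0 : ℝ) < ((k : ℝ) + 1)⁻¹ := fun k => by positivity
  refine ⟨fun k x => φ (((k : ℝ) + 1)⁻¹ • x), M, fun k => ?_, fun k => ?_, fun k x => ?_,
    fun k x => ?_, fun x => ?_⟩
  · exact hφ.comp (contDiff_const_smul _)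
  · exact φ.hasCompactSupport.comp_smul (hk k).ne'
  · rw [abs_of_nonneg φ.nonneg]
    exact φ.le_one
  · have h1 : HasFDerivAt (fun x : En n => ((k : ℝ) + 1)⁻¹ • x)
        (((k : ℝ) + 1)⁻¹ • ContinuousLinearMap.id ℝ (En n)) x :=
      (((k : ℝ) + 1)⁻¹ • ContinuousLinearMap.id ℝ (En n)).hasFDerivAt
    have h2 := ((hφ.differentiable one_ne_zero (((k : ℝ) + 1)⁻¹ • x)).hasFDerivAt.comp x h1).fderiv
    have h3 : fderiv ℝ (fun x => φ (((k : ℝ) + 1)⁻¹ • x)) x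
        = ((k : ℝ) + 1)⁻¹ • fderiv ℝ φ (((k : ℝ) + 1)⁻¹ • x) := by
      refine Eq.trans h2 ?_
      ext v
      simp
    rw [h3, norm_smul, Real.norm_of_nonneg (hk k).le]
    have h4 : ((k : ℝ) + 1)⁻¹ ≤ 1 := inv_le_one_of_one_le₀ (by linarith [k.cast_nonneg (α := ℝ)])
    calc _ ≤ 1 * ‖fderiv ℝ φ (((k : ℝ) + 1)⁻¹ • x)‖ := by gcongr
      _ ≤ M := by simpa using hM _
  · obtain ⟨N, hN⟩ := exists_nat_ge (‖x‖ + 1)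
    filter_upwards [eventually_ge_atTop N] with k hkN
    filter_upwards [Metric.ball_mem_nhds x one_pos] with y hy
    refine φ.one_of_mem_closedBall ?_
    have h1 : ‖y‖ ≤ k + 1 := by
      have : (N : ℝ) ≤ k := by exact_mod_cast hkN
      have h5 := norm_le_norm_add_norm_sub' y x
      rw [Metric.mem_ball, dist_eq_norm] at hy
      linarith
    rw [mem_closedBall_zero_iff, norm_smul, Real.norm_of_nonneg (hk k).le]
    change _ ≤ (1 : ℝ)
    rw [inv_mul_le_iff₀ (by positivity)]
    simpa using h1

theorem PoincareLE.of_integrable_sq {n : ℕ} {μ : Measure (En n)} [IsFiniteMeasure μ] {C : ℝ}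
    (hP : PoincareLE μ C) {g : En n → ℝ} (hg : ContDiff ℝ 1 g)
    (hi : Integrable (fun x => g x ^ 2) μ) (hi' : Integrable (fun x => ‖fderiv ℝ g x‖ ^ 2) μ) :
    (∫ x, (g x) ^ 2 ∂μ) - (∫ x, g x ∂μ) ^ 2 ≤ C * ∫ x, ‖fderiv ℝ g x‖ ^ 2 ∂μ := by
  obtain ⟨χ, M, hχ, hχc, hχ1, hχM, hχe⟩ := exists_smooth_cutoff n
  have hu : ∀ k, ContDiff ℝ 1 (fun x => χ k x * g x) := fun k => (hχ k).mul hg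
  have hev : ∀ x, ∀ᶠ k in atTop, (fun y => χ k y * g y) =ᶠ[𝓝 x] g := by
    intro x
    filter_upwards [hχe x] with k hk
    filter_upwards [hk] with y hy
    simp [hy]
  have h1 : Tendsto (fun k => ∫ x, (χ k x * g x) ^ 2 ∂μ) atTop (𝓝 (∫ x, (g x) ^ 2 ∂μ)) := by
    refine tendsto_integral_of_dominated_convergence _
      (fun k => ((hu k).continuous.pow 2).aestronglyMeasurable) hi
      (fun k => ae_of_all _ fun x => ?_) (ae_of_all _ fun x => ?_)
    · rw [mul_pow, norm_mul, norm_pow, Real.norm_eq_abs, norm_pow, Real.norm_eq_abs, sq_abs (g x)]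
      exact mul_le_of_le_one_left (sq_nonneg _) (pow_le_one₀ (abs_nonneg _) (hχ1 k x))
    · exact tendsto_const_nhds.congr' ((hev x).mono fun k hk => by
        have h := hk.eq_of_nhds
        dsimp only at h ⊢
        rw [h])
  have h2 : Tendsto (fun k => ∫ x, χ k x * g x ∂μ) atTop (𝓝 (∫ x, g x ∂μ)) := by
    refine tendsto_integral_of_dominated_convergence (fun x => 1 + g x ^ 2)
      (fun k => (hu k).continuous.aestronglyMeasurable) ((integrable_const _).add hi)
      (fun k => ae_of_all _ fun x => ?_) (ae_of_all _ fun x => ?_)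
    · rw [norm_mul, Real.norm_eq_abs, Real.norm_eq_abs]
      have := mul_le_of_le_one_left (abs_nonneg (g x)) (hχ1 k x)
      nlinarith [sq_abs (g x), sq_nonneg (|g x| - 1)]
    · exact tendsto_const_nhds.congr' ((hev x).mono fun k hk => by
        have h := hk.eq_of_nhds
        dsimp only at h ⊢
        rw [h])
  have h3 : Tendsto (fun k => ∫ x, ‖fderiv ℝ (fun y => χ k y * g y) x‖ ^ 2 ∂μ) atTop
      (𝓝 (∫ x, ‖fderiv ℝ g x‖ ^ 2 ∂μ)) := by
    refine tendsto_integral_of_dominated_convergence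
      (fun x => 2 * ‖fderiv ℝ g x‖ ^ 2 + 2 * M ^ 2 * g x ^ 2)
      (fun k => (((hu k).continuous_fderiv one_ne_zero).norm.pow 2).aestronglyMeasurable)
      ((hi'.const_mul 2).add (hi.const_mul (2 * M ^ 2)))
      (fun k => ae_of_all _ fun x => ?_) (ae_of_all _ fun x => ?_)
    · rw [norm_pow, norm_norm, fderiv_fun_mul (hχ k |>.differentiable one_ne_zero x)
        (hg.differentiable one_ne_zero x)]
      have hb : ‖χ k x • fderiv ℝ g x + g x • fderiv ℝ (χ k) x‖
          ≤ ‖fderiv ℝ g x‖ + |g x| * M := by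
        refine (norm_add_le _ _).trans (add_le_add ?_ ?_)
        · rw [norm_smul]
          exact mul_le_of_le_one_left (norm_nonneg _) (hχ1 k x)
        · rw [norm_smul, Real.norm_eq_abs]
          exact mul_le_mul_of_nonneg_left (hχM k x) (abs_nonneg _)
      refine (pow_le_pow_left₀ (norm_nonneg _) hb 2).trans ?_
      nlinarith [sq_nonneg (‖fderiv ℝ g x‖ - |g x| * M), sq_abs (g x)]
    · exact tendsto_const_nhds.congr' ((hev x).mono fun k hk => by
        dsimp only
        rw [hk.fderiv_eq])
  refine le_of_tendsto_of_tendsto' (h1.sub (h2.pow 2)) (h3.const_mul C) fun k => ?_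
  exact hP.of_hasCompactSupport (hu k) (hχc k).mul_right

theorem ae_norm_le_of_measSupport_subset {n : ℕ} {ν : Measure (En n)} {R : ℝ}
    (h : measSupport ν ⊆ Metric.closedBall (0 : En n) R) : ∀ᵐ z ∂ν, ‖z‖ ≤ R := by
  rw [ae_iff]
  refine measure_null_of_locally_null _ fun x hx => ?_
  have hx' : x ∉ measSupport ν := fun hmem => hx (by simpa using h hmem)
  simp only [measSupport, mem_ofPred_eq, not_forall, not_lt, nonpos_iff_eq_zero] at hx'
  obtain ⟨U, hU, hU0⟩ := hx'
  exact ⟨U, mem_nhdsWithin_of_mem_nhds hU, hU0⟩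

/-- The density of `ν * μ` with respect to `μ = e^{-H} dx`. -/
noncomputable def convDensity {n : ℕ} (ν : Measure (En n)) (H : En n → ℝ) (x : En n) : ℝ :=
  ∫ z, Real.exp (H x - H (x - z)) ∂ν

/-- A continuous integrand is locally bounded in the parameter, uniformly on the support of the
measure. -/
theorem exists_local_bound {n : ℕ} {ν : Measure (En n)} {R : ℝ} {F : Type*} [NormedAddCommGroup F] (hν : ∀ᵐ z ∂ν, ‖z‖ ≤ R)
    {Φ : En n → En n → F} (hΦ : Continuous fun p : En n × En n => Φ p.1 p.2) (x₀ : En n) :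
    ∃ M : ℝ, ∀ᵐ z ∂ν, ∀ x ∈ Metric.closedBall x₀ 1, ‖Φ x z‖ ≤ M := by
  obtain ⟨M, hM⟩ := ((isCompact_closedBall x₀ 1).prod
    (isCompact_closedBall (0 : En n) R)).exists_bound_of_continuousOn hΦ.continuousOn
  refine ⟨M, hν.mono fun z hz x hx => hM (x, z) ⟨hx, by simpa using hz⟩⟩

section ConvDensity

variable {n : ℕ} {ν : Measure (En n)} [IsProbabilityMeasure ν] {R : ℝ} {H : En n → ℝ}

theorem integrable_of_continuous (hν : ∀ᵐ z ∂ν, ‖z‖ ≤ R) {F : Type*} [NormedAddCommGroup F]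
    {Φ : En n → En n → F} (hΦ : Continuous fun p : En n × En n => Φ p.1 p.2) (x : En n) :
    Integrable (Φ x) ν := by
  obtain ⟨M, hM⟩ := exists_local_bound hν hΦ x
  exact (integrable_const M).mono' (hΦ.comp (Continuous.prodMk_right x)).aestronglyMeasurable
    (hM.mono fun z hz => hz x (Metric.mem_closedBall_self zero_le_one))

theorem continuous_integral_of_continuous (hν : ∀ᵐ z ∂ν, ‖z‖ ≤ R) {F : Type*}
    [NormedAddCommGroup F] [NormedSpace ℝ F]
    {Φ : En n → En n → F} (hΦ : Continuous fun p : En n × En n => Φ p.1 p.2) :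
    Continuous fun x => ∫ z, Φ x z ∂ν := by
  refine continuous_iff_continuousAt.2 fun x₀ => ?_
  obtain ⟨M, hM⟩ := exists_local_bound hν hΦ x₀
  refine MeasureTheory.continuousAt_of_dominated (bound := fun _ => M)
    (Eventually.of_forall fun x => (hΦ.comp (Continuous.prodMk_right x)).aestronglyMeasurable)
    ?_ (integrable_const M)
    (ae_of_all _ fun z => (hΦ.comp (Continuous.prodMk_left z)).continuousAt)
  filter_upwards [Metric.closedBall_mem_nhds x₀ one_pos] with x hx
  exact hM.mono fun z hz => hz x hx

theorem continuous_convDensity_integrand (hH : ContDiff ℝ 2 H) :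
    Continuous fun p : En n × En n => Real.exp (H p.1 - H (p.1 - p.2)) := by
  have := hH.continuous
  fun_prop

theorem continuous_convDensity_deriv_integrand (hH : ContDiff ℝ 2 H) :
    Continuous fun p : En n × En n =>
      Real.exp (H p.1 - H (p.1 - p.2)) • (fderiv ℝ H p.1 - fderiv ℝ H (p.1 - p.2)) := by
  have := hH.continuous
  have := hH.continuous_fderiv two_ne_zero
  fun_prop

theorem hasFDerivAt_convDensity (hν : ∀ᵐ z ∂ν, ‖z‖ ≤ R) (hH : ContDiff ℝ 2 H) (x₀ : En n) :
    HasFDerivAt (convDensity ν H)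
      (∫ z, Real.exp (H x₀ - H (x₀ - z)) • (fderiv ℝ H x₀ - fderiv ℝ H (x₀ - z)) ∂ν) x₀ := by
  have hc := continuous_convDensity_integrand hH
  have hc' := continuous_convDensity_deriv_integrand hH
  obtain ⟨M, hM⟩ := exists_local_bound hν
    (Φ := fun x z => Real.exp (H x - H (x - z)) • (fderiv ℝ H x - fderiv ℝ H (x - z))) hc' x₀
  have hd : Differentiable ℝ H := hH.differentiable two_ne_zero
  refine hasFDerivAt_integral_of_dominated_of_fderiv_le
    (F' := fun x z => Real.exp (H x - H (x - z)) • (fderiv ℝ H x - fderiv ℝ H (x - z)))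
    (Metric.closedBall_mem_nhds x₀ one_pos)
    (Eventually.of_forall fun x => (hc.comp (Continuous.prodMk_right x)).aestronglyMeasurable)
    (integrable_of_continuous hν (Φ := fun x z => Real.exp (H x - H (x - z))) hc x₀)
    (hc'.comp (Continuous.prodMk_right x₀)).aestronglyMeasurable hM (integrable_const M)
    (ae_of_all _ fun z x _ => ?_)
  have h1 : HasFDerivAt (fun x => H (x - z)) (fderiv ℝ H (x - z)) x :=
    (hasFDerivAt_comp_sub z).2 (hd (x - z)).hasFDerivAt
  exact ((hd x).hasFDerivAt.sub h1).exp

theorem contDiff_convDensity (hν : ∀ᵐ z ∂ν, ‖z‖ ≤ R) (hH : ContDiff ℝ 2 H) :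
    ContDiff ℝ 1 (convDensity ν H) := by
  refine contDiff_one_iff_fderiv.2
    ⟨fun x => (hasFDerivAt_convDensity hν hH x).differentiableAt, ?_⟩
  have : fderiv ℝ (convDensity ν H) = fun x =>
      ∫ z, Real.exp (H x - H (x - z)) • (fderiv ℝ H x - fderiv ℝ H (x - z)) ∂ν :=
    funext fun x => (hasFDerivAt_convDensity hν hH x).fderiv
  rw [this]
  exact continuous_integral_of_continuous hν (continuous_convDensity_deriv_integrand hH)

theorem convDensity_pos (hν : ∀ᵐ z ∂ν, ‖z‖ ≤ R) (hH : ContDiff ℝ 2 H) (x : En n) :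
    0 < convDensity ν H x :=
  integral_exp_pos (integrable_of_continuous hν (Φ := fun x z => Real.exp (H x - H (x - z)))
    (continuous_convDensity_integrand hH) x)

theorem norm_fderiv_convDensity_le (hν : ∀ᵐ z ∂ν, ‖z‖ ≤ R) (hH : ContDiff ℝ 2 H) {K : ℝ}
    (hK : 0 ≤ K) (hHess : ∀ x, ‖fderiv ℝ (fderiv ℝ H) x‖ ≤ K) (x : En n) :
    ‖fderiv ℝ (convDensity ν H) x‖ ≤ K * R * convDensity ν H x := by
  have hi := integrable_of_continuous hν (Φ := fun x z => Real.exp (H x - H (x - z)))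
    (continuous_convDensity_integrand hH) x
  have hH' : Differentiable ℝ (fderiv ℝ H) :=
    (hH.fderiv_right (m := 1) le_rfl).differentiable one_ne_zero
  rw [(hasFDerivAt_convDensity hν hH x).fderiv, convDensity, ← integral_const_mul]
  refine norm_integral_le_of_norm_le (hi.const_mul _) (hν.mono fun z hz => ?_)
  rw [norm_smul, Real.norm_of_nonneg (Real.exp_pos _).le, mul_comm]
  refine mul_le_mul_of_nonneg_right ?_ (Real.exp_pos _).le
  calc _ ≤ K * ‖x - (x - z)‖ := convex_univ.norm_image_sub_le_of_norm_fderiv_le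
        (fun y _ => hH' y) (fun y _ => hHess y) (mem_univ _) (mem_univ _)
    _ ≤ K * R := by
      rw [sub_sub_cancel]
      gcongr

theorem mconv_eq_withDensity (hν : ∀ᵐ z ∂ν, ‖z‖ ≤ R) (hH : ContDiff ℝ 2 H) :
    mconv ν (volume.withDensity fun x => ENNReal.ofReal (Real.exp (-H x)))
      = (volume.withDensity fun x => ENNReal.ofReal (Real.exp (-H x))).withDensity
        fun x => ENNReal.ofReal (convDensity ν H x) := by
  have hHc := hH.continuous
  have hρ : Measurable fun x => ENNReal.ofReal (Real.exp (-H x)) := by fun_prop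
  have hDm : Measurable fun x => ENNReal.ofReal (convDensity ν H x) :=
    (contDiff_convDensity hν hH).continuous.measurable.ennreal_ofReal
  have hD : ∀ x, ENNReal.ofReal (Real.exp (-H x)) * ENNReal.ofReal (convDensity ν H x)
      = ∫⁻ z, ENNReal.ofReal (Real.exp (-H (x - z))) ∂ν := by
    intro x
    have hi := integrable_of_continuous hν (Φ := fun x z => Real.exp (H x - H (x - z)))
      (continuous_convDensity_integrand hH) x
    rw [convDensity, ofReal_integral_eq_lintegral_ofReal hi
      (ae_of_all _ fun z => (Real.exp_pos _).le), ← lintegral_const_mul _ (by fun_prop)]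
    refine lintegral_congr fun z => ?_
    rw [← ENNReal.ofReal_mul (Real.exp_pos _).le, ← Real.exp_add]
    congr 2
    ring
  refine Measure.ext_of_lintegral _ fun φ hφ => ?_
  rw [lintegral_withDensity_eq_lintegral_mul _ hDm hφ,
    lintegral_withDensity_eq_lintegral_mul _ hρ (hDm.mul hφ), mconv,
    lintegral_map hφ (by fun_prop), lintegral_prod _ (by fun_prop)]
  calc _ = ∫⁻ z, ∫⁻ x, φ x * ENNReal.ofReal (Real.exp (-H (x - z))) ∂volume ∂ν := by
        refine lintegral_congr fun z => ?_
        rw [lintegral_withDensity_eq_lintegral_mul _ hρ (by fun_prop),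
          ← lintegral_sub_right_eq_self _ z]
        refine lintegral_congr fun x => ?_
        simp [mul_comm]
    _ = ∫⁻ x, ∫⁻ z, φ x * ENNReal.ofReal (Real.exp (-H (x - z))) ∂ν := by
        refine lintegral_lintegral_swap (Measurable.aemeasurable ?_)
        simp only [Function.uncurry_def]
        fun_prop
    _ = _ := by
        refine lintegral_congr fun x => ?_
        rw [lintegral_const_mul _ (by fun_prop), ← hD]
        simp only [Pi.mul_apply]
        ring

end ConvDensity

theorem PoincareLE.withDensity {n : ℕ} {μ : Measure (En n)} [IsProbabilityMeasure μ] {C : ℝ}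
    (hC : 0 ≤ C) (hP : PoincareLE μ C) {D : En n → ℝ} (hD : ContDiff ℝ 1 D) (hpos : ∀ x, 0 < D x)
    [hprob : IsProbabilityMeasure (μ.withDensity fun x => ENNReal.ofReal (D x))]
    {L : ℝ} (hL : ∀ x, ‖fderiv ℝ D x‖ ≤ L * D x) {ε : ℝ} (hε : 0 < ε)
    (hs : (1 + ε) / 4 * L ^ 2 * C < 1) :
    PoincareLE (μ.withDensity fun x => ENNReal.ofReal (D x))
      ((1 + ε⁻¹) / (1 - (1 + ε) / 4 * L ^ 2 * C) * C) := by
  have hDm : Measurable fun x => ENNReal.ofReal (D x) := hD.continuous.measurable.ennreal_ofReal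
  have hint : ∀ φ : En n → ℝ, ∫ x, φ x ∂(μ.withDensity fun x => ENNReal.ofReal (D x))
      = ∫ x, D x * φ x ∂μ := by
    intro φ
    rw [integral_withDensity_eq_integral_toReal_smul hDm (ae_of_all _ fun x => by simp)]
    simp [ENNReal.toReal_ofReal (hpos _).le]
  have hbdd : ∀ {φ : En n → ℝ} {M : ℝ}, Continuous φ → (∀ x, ‖φ x‖ ≤ M) →
      Integrable (fun x => D x * φ x) μ := by
    intro φ M hφ hM
    have h1 : Integrable φ (μ.withDensity fun x => ENNReal.ofReal (D x)) :=
      (integrable_const M).mono' hφ.aestronglyMeasurable (ae_of_all _ hM)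
    rw [integrable_withDensity_iff_integrable_smul' hDm (ae_of_all _ fun x => by simp)] at h1
    simpa [ENNReal.toReal_ofReal (hpos _).le] using h1
  have hDi : Integrable D μ := by
    simpa using hbdd (φ := fun _ => 1) (M := 1) continuous_const (by simp)
  have hD1 : ∫ x, D x ∂μ = 1 := by
    simpa using (hint fun _ => 1).symm
  intro f hf
  obtain ⟨hfc, ⟨M, hM⟩, N, hN⟩ := hf
  have hf1 : ContDiff ℝ 1 f := hfc.of_le (by exact_mod_cast le_top)
  have hf' : Continuous (fderiv ℝ f) := hf1.continuous_fderiv one_ne_zero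
  have hfN : ∀ x, ‖fderiv ℝ f x‖ ≤ N := fun x => norm_fderiv_le_of_lipschitz ℝ hN
  set q : En n → ℝ := fun x => √(D x) with hq
  have hq0 : ∀ x, 0 < q x := fun x => Real.sqrt_pos.2 (hpos x)
  have hq2 : ∀ x, q x ^ 2 = D x := fun x => Real.sq_sqrt (hpos x).le
  have hqc : ContDiff ℝ 1 q := hD.sqrt fun x => (hpos x).ne'
  have hqi : Integrable q μ := by
    refine ((integrable_const (1 : ℝ)).add hDi).mono' hqc.continuous.aestronglyMeasurable
      (ae_of_all _ fun x => ?_)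
    rw [Real.norm_of_nonneg (hq0 x).le]
    simp only [Pi.add_apply]
    nlinarith [hq2 x, sq_nonneg (q x - 1)]
  have hqpos : 0 < ∫ x, q x ∂μ := by
    rw [integral_pos_iff_support_of_nonneg (fun x => (hq0 x).le) hqi,
      Function.support_eq_univ fun x => (hq0 x).ne']
    simp
  have hfqi : Integrable (fun x => f x * q x) μ :=
    hqi.bdd_mul hf1.continuous.aestronglyMeasurable (ae_of_all _ hM)
  obtain ⟨a, ha⟩ : ∃ a, ∫ x, (f x - a) * q x ∂μ = 0 := by
    refine ⟨(∫ x, f x * q x ∂μ) / ∫ x, q x ∂μ, ?_⟩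
    simp_rw [sub_mul]
    rw [integral_sub hfqi (hqi.const_mul _), integral_const_mul, div_mul_cancel₀ _ hqpos.ne',
      sub_self]
  have hgc : ContDiff ℝ 1 fun x => (f x - a) * q x := (hf1.sub contDiff_const).mul hqc
  have hqd : ∀ x, ‖fderiv ℝ q x‖ ≤ L / 2 * q x := by
    intro x
    rw [((hD.differentiable one_ne_zero x).hasFDerivAt.sqrt (hpos x).ne').fderiv, norm_smul,
      Real.norm_of_nonneg (by positivity)]
    calc _ ≤ 1 / (2 * √(D x)) * (L * D x) := by gcongr; exact hL x
      _ = L / 2 * q x := by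
        change 1 / (2 * q x) * _ = _
        have := (hq0 x).ne'
        rw [← hq2 x]
        field_simp
  have hgd : ∀ x, ‖fderiv ℝ (fun x => (f x - a) * q x) x‖ ^ 2
      ≤ (1 + ε⁻¹) * (D x * ‖fderiv ℝ f x‖ ^ 2)
        + (1 + ε) / 4 * L ^ 2 * (D x * (f x - a) ^ 2) := by
    intro x
    have hfd : DifferentiableAt ℝ f x := hf1.differentiable one_ne_zero x
    rw [fderiv_fun_mul (hfd.sub_const a) (hqc.differentiable one_ne_zero x), fderiv_sub_const]
    have h1 : ‖(f x - a) • fderiv ℝ q x + q x • fderiv ℝ f x‖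
        ≤ q x * (‖fderiv ℝ f x‖ + |f x - a| * (L / 2)) := by
      refine (norm_add_le _ _).trans ?_
      rw [norm_smul, norm_smul, Real.norm_eq_abs, Real.norm_of_nonneg (hq0 x).le]
      nlinarith [mul_le_mul_of_nonneg_left (hqd x) (abs_nonneg (f x - a))]
    refine (pow_le_pow_left₀ (norm_nonneg _) h1 2).trans ?_
    rw [mul_pow, hq2]
    have h2 : ∀ u v : ℝ, (u + v) ^ 2 ≤ (1 + ε⁻¹) * u ^ 2 + (1 + ε) * v ^ 2 := by
      intro u v
      have h3 : (1 + ε⁻¹) * u ^ 2 + (1 + ε) * v ^ 2 - (u + v) ^ 2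
          = ε⁻¹ * (u - ε * v) ^ 2 := by
        field_simp
        ring
      have h4 : 0 ≤ ε⁻¹ * (u - ε * v) ^ 2 := by positivity
      linarith
    calc _ ≤ D x * ((1 + ε⁻¹) * ‖fderiv ℝ f x‖ ^ 2 + (1 + ε) * (|f x - a| * (L / 2)) ^ 2) :=
          mul_le_mul_of_nonneg_left (h2 _ _) (hpos x).le
      _ = _ := by
        rw [mul_pow, sq_abs]
        ring
  have hi1 : Integrable (fun x => D x * ‖fderiv ℝ f x‖ ^ 2) μ := by
    refine hbdd (M := (N : ℝ) ^ 2) (hf'.norm.pow 2) fun x => ?_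
    rw [norm_pow, norm_norm]
    exact pow_le_pow_left₀ (norm_nonneg _) (hfN x) 2
  have hi2 : Integrable (fun x => D x * (f x - a) ^ 2) μ := by
    refine hbdd (M := (M + |a|) ^ 2) ((hf1.continuous.sub continuous_const).pow 2) fun x => ?_
    rw [norm_pow]
    refine pow_le_pow_left₀ (norm_nonneg _) ?_ 2
    exact (norm_sub_le _ _).trans (add_le_add_left (hM x) _)
  have hi3 : Integrable (fun x => D x * f x) μ := hbdd hf1.continuous hM
  have hi4 : Integrable (fun x => D x * f x ^ 2) μ := by
    refine hbdd (M := M ^ 2) (hf1.continuous.pow 2) fun x => ?_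
    rw [norm_pow]
    exact pow_le_pow_left₀ (norm_nonneg _) (hM x) 2
  have hg2 : ∀ x, ((f x - a) * q x) ^ 2 = D x * (f x - a) ^ 2 := fun x => by
    rw [mul_pow, hq2, mul_comm]
  have hbi := (hi1.const_mul (1 + ε⁻¹)).add (hi2.const_mul ((1 + ε) / 4 * L ^ 2))
  have hgi : Integrable (fun x => ‖fderiv ℝ (fun x => (f x - a) * q x) x‖ ^ 2) μ := by
    refine hbi.mono' ((hgc.continuous_fderiv one_ne_zero).norm.pow 2).aestronglyMeasurable
      (ae_of_all _ fun x => ?_)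
    rw [norm_pow, norm_norm]
    exact hgd x
  have hmain := hP.of_integrable_sq hgc (by simpa only [hg2] using hi2) hgi
  have hmono := integral_mono hgi hbi hgd
  simp only [Pi.add_apply] at hmono
  rw [integral_add (hi1.const_mul _) (hi2.const_mul _), integral_const_mul,
    integral_const_mul] at hmono
  simp only [hg2] at hmain
  rw [ha] at hmain
  have hJ : ∫ x, D x * (f x - a) ^ 2 ∂μ
      = ∫ x, D x * f x ^ 2 ∂μ - 2 * a * ∫ x, D x * f x ∂μ + a ^ 2 := by
    have : ∀ x, D x * (f x - a) ^ 2 = D x * f x ^ 2 - 2 * a * (D x * f x) + a ^ 2 * D x :=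
      fun x => by ring
    simp_rw [this]
    have hi5 : Integrable (fun x => D x * f x ^ 2 - 2 * a * (D x * f x)) μ :=
      hi4.sub (hi3.const_mul _)
    rw [integral_add hi5 (hDi.const_mul _),
      integral_sub hi4 (hi3.const_mul _), integral_const_mul, integral_const_mul, hD1, mul_one]
  simp only [hint, norm_gradient]
  have hs' : 0 < 1 - (1 + ε) / 4 * L ^ 2 * C := by linarith
  have hmono' := mul_le_mul_of_nonneg_left hmono hC
  have hvar : ∫ x, D x * f x ^ 2 ∂μ - (∫ x, D x * f x ∂μ) ^ 2
      ≤ ∫ x, D x * (f x - a) ^ 2 ∂μ := by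
    rw [hJ]
    nlinarith [sq_nonneg ((∫ x, D x * f x ∂μ) - a)]
  refine hvar.trans ?_
  rw [div_mul_eq_mul_div, div_mul_eq_mul_div, le_div_iff₀ hs']
  nlinarith

end Auxiliary


/-- For `ν` supported in `B(0,R)` and `ν^H = ν * μ` with
`μ = e^{-H} dx`, `sup_x |Hess H(x)| = K < ∞`, if `s := (1+ε)/4 · K² R² C_P(μ) < 1`
then `C_P(ν^H) ≤ (1+ε⁻¹)/(1-s) · C_P(μ)`. -/
theorem poincare_of_general_mollification
    {n : ℕ} (ν : Measure (En n)) [IsProbabilityMeasure ν]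
    (R : ℝ) (hR : 0 ≤ R)
    (hsupp : measSupport ν ⊆ Metric.closedBall (0 : En n) R)
    (H : En n → ℝ) (hH : ContDiff ℝ 2 H)
    (μ : Measure (En n)) [IsProbabilityMeasure μ]
    (hμ : μ = volume.withDensity fun x => ENNReal.ofReal (Real.exp (-H x)))
    (K : ℝ) (hK : 0 ≤ K) (hHess : ∀ x, ‖fderiv ℝ (fderiv ℝ H) x‖ ≤ K)
    (Cμ : ℝ) (hCμ : 0 ≤ Cμ) (hP : PoincareLE μ Cμ)
    (ε : ℝ) (hε : 0 < ε)
    (hs : (1 + ε) / 4 * K ^ 2 * R ^ 2 * Cμ < 1) :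
    PoincareLE (mconv ν μ)
      ((1 + ε⁻¹) / (1 - (1 + ε) / 4 * K ^ 2 * R ^ 2 * Cμ) * Cμ) := by
  have hν := ae_norm_le_of_measSupport_subset hsupp
  have hconv : mconv ν μ = μ.withDensity fun x => ENNReal.ofReal (convDensity ν H x) := by
    rw [hμ]
    exact mconv_eq_withDensity hν hH
  have : IsProbabilityMeasure (mconv ν μ) :=
    Measure.isProbabilityMeasure_map (by fun_prop)
  rw [hconv] at this ⊢
  rw [mul_assoc _ (K ^ 2), ← mul_pow] at hs ⊢
  exact hP.withDensity hCμ (contDiff_convDensity hν hH) (convDensity_pos hν hH)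
    (norm_fderiv_convDensity_le hν hH hK hHess) hε hs
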